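/- arXiv:2404.01971 — 6 statements merged into one kernel-verified Lean document; each statement's English description precedes it below -/
import Mathlib

section
/- Let ρ be the rank function of a matricube on the hypercuboid C(r). The set Fl of flats of the matricube is stable under the meet operation ∧ of C(r): if a and b are flats, then a ∧ b is a flat. -/
namespace Matricube

variable {d : ℕ}

/-- Membership in the hypercuboid `C(r)` of width `r`. -/
def mem (r x : Fin d → ℕ) : Prop := ∀ i, x i ≤ r i

/-- The `i`-th standard unit vector `eᵢ`. -/
def e (d : ℕ) (i : Fin d) : Fin d → ℕ := fun j => if j = i then 1 else 0

/-- The point `t · eᵢ` of the hypercuboid. -/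
def unit (d : ℕ) (i : Fin d) (t : ℕ) : Fin d → ℕ := fun j => if j = i then t else 0

/-- Submodularity of a function on the hypercuboid `C(r)`. -/
def Submodular (r : Fin d → ℕ) (f : (Fin d → ℕ) → ℤ) : Prop :=
  ∀ x y : Fin d → ℕ, mem r x → mem r y → f (x ⊔ y) + f (x ⊓ y) ≤ f x + f y

/-- Axioms (R1)-(R2)-(R3) for the rank function of a matricube on `C(r)`. -/
def IsRankFunction (r : Fin d → ℕ) (ρ : (Fin d → ℕ) → ℤ) : Prop :=
  (ρ 0 = 0 ∧ ∀ i : Fin d, ∀ t : ℕ, 1 ≤ t → t ≤ r i →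
      ρ (unit d i t) - ρ (unit d i (t - 1)) ≤ 1) ∧
  (∀ x y : Fin d → ℕ, mem r x → mem r y → x ≤ y → ρ x ≤ ρ y) ∧
  Submodular r ρ

/-- Axiom (R1*): the matricube is simple. -/
def IsSimple (r : Fin d → ℕ) (ρ : (Fin d → ℕ) → ℤ) : Prop :=
  ∀ i : Fin d, 0 < r i ∧ ∀ t : ℕ, t ≤ r i → ρ (unit d i t) = (t : ℤ)

/-- A flat of the matricube given by the rank function `ρ` on `C(r)`. -/
def IsFlat (r : Fin d → ℕ) (ρ : (Fin d → ℕ) → ℤ) (a : Fin d → ℕ) : Prop :=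
  mem r a ∧ ∀ i : Fin d, mem r (a + e d i) → ρ (a + e d i) = ρ a + 1

/-- The set of flats of the matricube given by `ρ`. -/
def flats (r : Fin d → ℕ) (ρ : (Fin d → ℕ) → ℤ) : Set (Fin d → ℕ) :=
  {a | IsFlat r ρ a}

/-- `CoversIn S a b` : `b` covers `a` in the poset `S`. -/
def CoversIn (S : Set (Fin d → ℕ)) (a b : Fin d → ℕ) : Prop :=
  a ∈ S ∧ b ∈ S ∧ a < b ∧ ∀ z ∈ S, ¬(a < z ∧ z < b)

/-- The rank function of the dual matricube. -/
def dualRank (r : Fin d → ℕ) (ρ : (Fin d → ℕ) → ℤ) : (Fin d → ℕ) → ℤ :=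
  fun x => (∑ i, (x i : ℤ)) + ρ (r - x) - ρ r

/-- Join-closure of a set: joins of nonempty (finite) families of its elements. -/
def joinClosure (A : Set (Fin d → ℕ)) : Set (Fin d → ℕ) :=
  {x | ∃ S : Finset (Fin d → ℕ), S.Nonempty ∧ ↑S ⊆ A ∧ x = S.sup id}

/-- `a` is join-irreducible in `A` : `a` is not the join of any set of elements of `A \ {a}`. -/
def JoinIrredIn (A : Set (Fin d → ℕ)) (a : Fin d → ℕ) : Prop :=
  ∀ S : Finset (Fin d → ℕ), S.Nonempty → ↑S ⊆ A \ {a} → S.sup id ≠ a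

/-- The set of circuits of the matricube given by `ρ` on `C(r)`: the nonzero
join-irreducible elements of `CC = {r - a : a a flat of the dual matricube}`. -/
def circuits (r : Fin d → ℕ) (ρ : (Fin d → ℕ) → ℤ) : Set (Fin d → ℕ) :=
  {c | c ∈ (fun a => r - a) '' flats r (dualRank r ρ) ∧ c ≠ 0 ∧
    JoinIrredIn ((fun a => r - a) '' flats r (dualRank r ρ)) c}

/-- An independent of the matricube given by `ρ` on `C(r)`. -/
def IsIndep (r : Fin d → ℕ) (ρ : (Fin d → ℕ) → ℤ) (a : Fin d → ℕ) : Prop :=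
  mem r a ∧ ∀ i : Fin d, 1 ≤ a i → ρ (a - e d i) = ρ a - 1

/-- The set of independents of the matricube given by `ρ`. -/
def indeps (r : Fin d → ℕ) (ρ : (Fin d → ℕ) → ℤ) : Set (Fin d → ℕ) :=
  {a | IsIndep r ρ a}

/-- `b` is the removal of `i` in `a` (in `J`): `b ∈ J` differs from `a` only in the `i`-th
coordinate, `b i < a i`, and `b` has the largest `i`-th coordinate among such elements. -/
def IsRemovalAt (J : Set (Fin d → ℕ)) (a : Fin d → ℕ) (i : Fin d) (b : Fin d → ℕ) : Prop :=
  b ∈ J ∧ b i < a i ∧ (∀ j : Fin d, j ≠ i → b j = a j) ∧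
  ∀ c ∈ J, c i < a i → (∀ j : Fin d, j ≠ i → c j = a j) → c i ≤ b i

/-- `b` is a removal of `a` in `J`. -/
def IsRemoval (J : Set (Fin d → ℕ)) (a b : Fin d → ℕ) : Prop :=
  ∃ i : Fin d, IsRemovalAt J a i b

/-- Removals exist in `J`. -/
def RemovalsExist (J : Set (Fin d → ℕ)) : Prop :=
  ∀ a ∈ J, ∀ i : Fin d, 1 ≤ a i → ∃ b, IsRemovalAt J a i b

/-- `a` can be reduced to `0` by a sequence of `m` removals in `J`. -/
def ReducesTo (J : Set (Fin d → ℕ)) (a : Fin d → ℕ) (m : ℕ) : Prop :=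
  ∃ c : ℕ → (Fin d → ℕ), c 0 = a ∧ c m = 0 ∧ ∀ k, k < m → IsRemoval J (c k) (c (k + 1))

/-- `J` is orderable: removals exist and all sequences of removals reducing a given
element to `0` have the same length. -/
def Orderable (J : Set (Fin d → ℕ)) : Prop :=
  RemovalsExist J ∧
  ∀ a ∈ J, ∀ m₁ m₂ : ℕ, ReducesTo J a m₁ → ReducesTo J a m₂ → m₁ = m₂

/-- Axiom (I1) for independents. -/
def AxiomI1 (J : Set (Fin d → ℕ)) : Prop :=
  RemovalsExist J ∧
  ∀ p ∈ J, ∀ i j : Fin d, ∀ bi bj : Fin d → ℕ,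
    IsRemovalAt J p i bi → IsRemovalAt J p j bj →
    bi ⊓ bj ∈ J ∧
    {c ∈ J | bi ⊓ bj ≤ c ∧ c ≤ bi}.ncard = {c ∈ J | bi ⊓ bj ≤ c ∧ c ≤ bj}.ncard

/-- Axiom (I2) for independents, relative to a size function `sz`. -/
def AxiomI2 (J : Set (Fin d → ℕ)) (sz : (Fin d → ℕ) → ℕ) : Prop :=
  (∀ a ∈ J, ∀ b ∈ J, a < b → sz a < sz b) ∧
  ∀ a ∈ J, ∀ b ∈ J, sz a < sz b → 2 ≤ {k : Fin d | a k < b k}.ncard →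
    ∃ c ∈ J, c ≤ a ⊔ b ∧ sz a < sz c ∧ ∃ i : Fin d, a i < b i ∧ c i < b i

/-- `P` is a dot array on the hypercube `[r]^d`. -/
def IsDotArray (r : ℕ) (P : Set (Fin d → ℕ)) : Prop := ∀ x ∈ P, ∀ i, x i ≤ r

/-- `rank_j (P[a])`: the number of values `t` such that the upper principal subarray
`P[a]` contains a dot whose `j`-th coordinate equals `t`. -/
noncomputable def arrayRank (P : Set (Fin d → ℕ)) (a : Fin d → ℕ) (j : Fin d) : ℕ :=
  {t : ℕ | ∃ y ∈ P, a ≤ y ∧ y j = t}.ncard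

/-- `x` is a redundant position in the dot array `P`: `x` is the meet of at least two dotted
positions `≠ x`, each having at least one coordinate in common with `x`. -/
def Redundant (P : Set (Fin d → ℕ)) (x : Fin d → ℕ) : Prop :=
  ∃ S : Finset (Fin d → ℕ), 2 ≤ S.card ∧ ↑S ⊆ P \ {x} ∧
    (∀ y ∈ S, ∃ i, y i = x i) ∧ (∀ y ∈ S, x ≤ y) ∧ ∀ z : Fin d → ℕ, (∀ y ∈ S, z ≤ y) → z ≤ x

/-- A permutation array of width `r` and dimension `d`: a totally rankable dot array on
`[r]^d` of rank `r + 1` with no redundant dots. -/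
def IsPermutationArray (r : ℕ) (P : Set (Fin d → ℕ)) : Prop :=
  IsDotArray r P ∧
  (∀ a : Fin d → ℕ, (∀ i, a i ≤ r) → ∀ j j' : Fin d, arrayRank P a j = arrayRank P a j') ∧
  (∀ j : Fin d, arrayRank P 0 j = r + 1) ∧
  (∀ x ∈ P, ¬Redundant P x)

/-- An increasing path `c 0 = 0, …, c m = a` in `C(r)`, with step directions `ℓ`. -/
def IncPath (r : Fin d → ℕ) (c : ℕ → Fin d → ℕ) (ℓ : ℕ → Fin d) (m : ℕ)
    (a : Fin d → ℕ) : Prop :=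
  c 0 = 0 ∧ c m = a ∧ ∀ j, j < m → c (j + 1) = c j + e d (ℓ j) ∧ mem r (c (j + 1))

theorem mem_add_e_iff {r x : Fin d → ℕ} (hx : mem r x) (i : Fin d) :
    mem r (x + e d i) ↔ x i + 1 ≤ r i := by
  refine ⟨fun h => by simpa [e] using h i, fun h j => ?_⟩
  by_cases hj : j = i
  · subst hj
    simpa [e] using h
  · simpa [e, hj] using hx j

/-- A unit step raises the rank by at most one. -/
theorem IsRankFunction.rank_add_e_le {r : Fin d → ℕ} {ρ : (Fin d → ℕ) → ℤ}
    (h : IsRankFunction r ρ) {x : Fin d → ℕ} {i : Fin d} (hx : mem r x)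
    (hxi : mem r (x + e d i)) : ρ (x + e d i) ≤ ρ x + 1 := by
  have hi := (mem_add_e_iff hx i).1 hxi
  have hu : mem r (unit d i (x i + 1)) := fun j => by
    by_cases hj : j = i
    · subst hj
      simpa [unit] using hi
    · simp [unit, hj]
  have hsup : x ⊔ unit d i (x i + 1) = x + e d i := by
    ext j
    by_cases hj : j = i
    · subst hj
      simp [unit, e]
    · simp [unit, e, hj]
  have hinf : x ⊓ unit d i (x i + 1) = unit d i (x i) := by
    ext j
    by_cases hj : j = i
    · subst hj
      simp [unit]
    · simp [unit, hj]
  have hsub := h.2.2 x _ hx hu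
  rw [hsup, hinf] at hsub
  have hstep := h.1.2 i (x i + 1) (Nat.le_add_left 1 _) hi
  rw [Nat.add_sub_cancel] at hstep
  linarith

/-- Below a flat `a`, a unit step in a direction where the coordinates agree raises the rank. -/
theorem IsFlat.rank_add_one_le {r : Fin d → ℕ} {ρ : (Fin d → ℕ) → ℤ} (h : Submodular r ρ)
    {a x : Fin d → ℕ} (ha : IsFlat r ρ a) (hxa : x ≤ a) {i : Fin d} (hi : x i = a i)
    (hxi : mem r (x + e d i)) : ρ x + 1 ≤ ρ (x + e d i) := by
  have hx : mem r x := fun j => (hxa j).trans (ha.1 j)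
  have hai : mem r (a + e d i) :=
    (mem_add_e_iff ha.1 i).2 (hi ▸ (mem_add_e_iff hx i).1 hxi)
  have hsup : (x + e d i) ⊔ a = a + e d i := by
    ext j
    by_cases hj : j = i
    · subst hj
      simp [e, hi]
    · simpa [e, hj] using hxa j
  have hinf : (x + e d i) ⊓ a = x := by
    ext j
    by_cases hj : j = i
    · subst hj
      simp [e, hi]
    · simpa [e, hj] using hxa j
  have hsub := h _ a hxi ha.1
  rw [hsup, hinf, ha.2 i hai] at hsub
  linarith

/-- The set of flats of a matricube is stable under meet. -/
theorem flats_meet_closed (d : ℕ) (r : Fin d → ℕ) (ρ : (Fin d → ℕ) → ℤ)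
    (h : IsRankFunction r ρ) (a b : Fin d → ℕ)
    (ha : IsFlat r ρ a) (hb : IsFlat r ρ b) :
    IsFlat r ρ (a ⊓ b) := by
  have hm : mem r (a ⊓ b) := fun j => inf_le_left.trans (ha.1 j)
  refine ⟨hm, fun i hi => le_antisymm (h.rank_add_e_le hm hi) ?_⟩
  rcases le_total (a i) (b i) with hab | hab
  · exact ha.rank_add_one_le h.2.2 inf_le_left (inf_eq_left.2 hab) hi
  · exact hb.rank_add_one_le h.2.2 inf_le_right (inf_eq_right.2 hab) hi

end Matricube
end

section
/- Let ρ be the rank function of a matricube on the hypercuboid C(r), let x ∈ C(r), and let c be the minimum flat with c ⊒ x (which exists since flats are closed under meet and r is a flat). Then: (1) ρ(c) = ρ(x); and (2) for every i ∈ {1, …, d} such that x + e_i ∈ C(r), if c_i > x_i then ρ(x + e_i) = ρ(x), and if c_i = x_i then ρ(x + e_i) = ρ(x) + 1. -/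
namespace Matricube

variable {d : ℕ}

/-- Adding a unit vector raises the rank by at most one. -/
theorem IsRankFunction.add_e_le {r : Fin d → ℕ} {ρ : (Fin d → ℕ) → ℤ} (h : IsRankFunction r ρ)
    {a : Fin d → ℕ} {i : Fin d} (ha : mem r (a + e d i)) : ρ (a + e d i) ≤ ρ a + 1 := by
  have hi : a i + 1 ≤ r i := by simpa [e] using ha i
  have hmem : mem r a := fun j => le_trans (Nat.le_add_right _ _) (ha j)
  have hunit : mem r (unit d i (a i + 1)) := by
    intro j
    by_cases hj : j = i
    · subst hj; simpa [unit] using hi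
    · simp [unit, hj]
  have hsup : a ⊔ unit d i (a i + 1) = a + e d i := by
    ext j
    by_cases hj : j = i
    · subst hj; simp [unit, e]
    · simp [unit, e, hj]
  have hinf : a ⊓ unit d i (a i + 1) = unit d i (a i) := by
    ext j
    by_cases hj : j = i
    · subst hj; simp [unit]
    · simp [unit, hj]
  have hsub := h.2.2 a _ hmem hunit
  rw [hsup, hinf] at hsub
  have hstep := h.1.2 i (a i + 1) (by omega) hi
  rw [Nat.add_sub_cancel] at hstep
  linarith

/-- Every point of the hypercuboid lies below a flat of the same rank. -/
theorem IsRankFunction.exists_isFlat_ge {r : Fin d → ℕ} {ρ : (Fin d → ℕ) → ℤ}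
    (h : IsRankFunction r ρ) {x : Fin d → ℕ} (hx : mem r x) :
    ∃ y, IsFlat r ρ y ∧ x ≤ y ∧ ρ y = ρ x := by
  have hfin : {y | mem r y ∧ x ≤ y ∧ ρ y = ρ x}.Finite :=
    (Set.finite_Iic r).subset fun y hy => hy.1
  obtain ⟨y, ⟨hy, hxy, hρ⟩, hmax⟩ := hfin.exists_maximal ⟨x, hx, le_rfl, rfl⟩
  refine ⟨y, ⟨hy, fun i hi => ?_⟩, hxy, hρ⟩
  have hle : y ≤ y + e d i := le_self_add
  refine le_antisymm (h.add_e_le hi) (Int.add_one_le_of_lt ?_)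
  refine lt_of_le_of_ne (h.2.1 _ _ hy hi hle) fun heq => ?_
  have := hmax ⟨hi, hxy.trans hle, heq.symm.trans hρ⟩ hle i
  simp [e] at this

/-- Properties of the minimum flat `c` above a point `x` of a matricube. -/
theorem min_flat_above (d : ℕ) (r : Fin d → ℕ) (ρ : (Fin d → ℕ) → ℤ)
    (h : IsRankFunction r ρ) (x c : Fin d → ℕ) (hx : mem r x)
    (hc : IsFlat r ρ c) (hxc : x ≤ c)
    (hmin : ∀ c' : Fin d → ℕ, IsFlat r ρ c' → x ≤ c' → c ≤ c') :
    ρ c = ρ x ∧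
    ∀ i : Fin d, mem r (x + e d i) →
      (x i < c i → ρ (x + e d i) = ρ x) ∧ (c i = x i → ρ (x + e d i) = ρ x + 1) := by
  obtain ⟨y, hy, hxy, hρ⟩ := h.exists_isFlat_ge hx
  have hcx : ρ c = ρ x :=
    le_antisymm ((h.2.1 _ _ hc.1 hy.1 (hmin y hy hxy)).trans hρ.le) (h.2.1 _ _ hx hc.1 hxc)
  refine ⟨hcx, fun i hi => ⟨fun hlt => ?_, fun heq => ?_⟩⟩
  · have hle : x + e d i ≤ c := by
      intro j
      by_cases hj : j = i
      · subst hj; simpa [e] using hlt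
      · simpa [e, hj] using hxc j
    exact le_antisymm ((h.2.1 _ _ hi hc.1 hle).trans hcx.le) (h.2.1 _ _ hx hi le_self_add)
  · have hsup : c ⊔ (x + e d i) = c + e d i := by
      ext j
      by_cases hj : j = i
      · subst hj; simp [e, heq]
      · simpa [e, hj] using hxc j
    have hinf : c ⊓ (x + e d i) = x := by
      ext j
      by_cases hj : j = i
      · subst hj; simp [e, heq]
      · simpa [e, hj] using hxc j
    have hci : mem r (c + e d i) := hsup ▸ fun j => sup_le (hc.1 j) (hi j)
    have hsub := h.2.2 c _ hc.1 hi
    rw [hsup, hinf, hc.2 i hci] at hsub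
    exact le_antisymm (h.add_e_le hi) (by linarith)

end Matricube
end

section
/- Let F ⊆ C(r) be a subset satisfying axioms (F1) and (F2). Then F, with the partial order induced from C(r), is a lattice (its meet is the meet of C(r), and the join of a, b ∈ F is the meet of all common upper bounds of a and b in F). If moreover F satisfies (F3), then F has the diamond property: for every a, b, c ∈ F with b ≠ c such that b and c both cover a in F, the join b ∨ c in F covers both b and c; consequently all maximal chains of F have the same length. -/
namespace Matricube

variable {d : ℕ}

/-- `j` is the join (least upper bound) of `a` and `b` inside the subposet `F`. -/
def IsJoinIn (F : Set (Fin d → ℕ)) (a b j : Fin d → ℕ) : Prop :=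
  j ∈ F ∧ a ≤ j ∧ b ≤ j ∧ ∀ u ∈ F, a ≤ u → b ≤ u → j ≤ u

/-- `S` is a maximal chain of the subposet `F`. -/
def MaxChainIn (F S : Set (Fin d → ℕ)) : Prop :=
  S ⊆ F ∧ IsChain (· ≤ ·) S ∧
  ∀ S' : Set (Fin d → ℕ), S' ⊆ F → IsChain (· ≤ ·) S' → S ⊆ S' → S = S'

/-- A nonempty set that is closed under meets and satisfies the descending chain condition has a
least element. -/
theorem exists_isLeast_of_infClosed {α : Type*} [SemilatticeInf α] [WellFoundedLT α] {s : Set α}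
    (hs : InfClosed s) (hne : s.Nonempty) : ∃ m, IsLeast s m := by
  obtain ⟨m, hm, hmin⟩ := wellFounded_lt.has_min s hne
  refine ⟨m, hm, fun u hu => ?_⟩
  by_contra hmu
  exact hmin _ (hs hm hu) (inf_le_left.lt_of_ne fun h => hmu (inf_eq_left.mp h))

section SaturatedPath

variable {α : Type*} [PartialOrder α] [OrderTop α]

/-- `SaturatedPath a n` : there is a sequence of `n` successive covers from `a` to `⊤`. -/
inductive SaturatedPath : α → ℕ → Prop
  | top : SaturatedPath ⊤ 0
  | step {a b : α} {n : ℕ} : a ⋖ b → SaturatedPath b n → SaturatedPath a (n + 1)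

theorem exists_saturatedPath [Finite α] (a : α) : ∃ n, SaturatedPath a n := by
  induction a using WellFoundedGT.induction with
  | ind a ih =>
    rcases eq_or_ne a ⊤ with rfl | ha
    · exact ⟨0, .top⟩
    · obtain ⟨b, hab, -⟩ := exists_covBy_le_of_lt (lt_top_iff_ne_top.mpr ha)
      obtain ⟨n, hn⟩ := ih b hab.lt
      exact ⟨n + 1, .step hab hn⟩

theorem SaturatedPath.length_unique [Finite α]
    (hdiamond : ∀ a b c : α, b ≠ c → a ⋖ b → a ⋖ c → ∃ j, b ⋖ j ∧ c ⋖ j)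
    {a : α} {m n : ℕ} (hm : SaturatedPath a m) (hn : SaturatedPath a n) : m = n := by
  induction a using WellFoundedGT.induction generalizing m n with
  | ind a ih =>
    cases hm with
    | top =>
      cases hn with
      | top => rfl
      | step h _ => exact absurd h.lt not_top_lt
    | @step _ b m hab hbm =>
      cases hn with
      | top => exact absurd hab.lt not_top_lt
      | @step _ c n hac hcn =>
        rcases eq_or_ne b c with rfl | hbc
        · rw [ih b hab.lt hbm hcn]
        · obtain ⟨j, hbj, hcj⟩ := hdiamond a b c hbc hab hac
          obtain ⟨k, hk⟩ := exists_saturatedPath j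
          rw [ih b hab.lt hbm (.step hbj hk), ih c hac.lt hcn (.step hcj hk)]

/-- An element comparable with every element of a maximal chain belongs to the chain. -/
theorem mem_of_isMaxChain_of_comparable {β : Type*} [Preorder β] {S : Set β}
    (hS : IsMaxChain (· ≤ ·) S) {z : β} (hz : ∀ y ∈ S, z ≤ y ∨ y ≤ z) : z ∈ S :=
  hS.2 (hS.1.insert fun y hy _ => hz y hy) (Set.subset_insert z S) ▸ Set.mem_insert z S

theorem saturatedPath_ncard_of_isMaxChain [Finite α] {S : Set α} (hS : IsMaxChain (· ≤ ·) S)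
    {a : α} (ha : a ∈ S) : SaturatedPath a (S ∩ Set.Ioi a).ncard := by
  induction a using WellFoundedGT.induction with
  | ind a ih =>
    rcases eq_or_ne a ⊤ with rfl | hne
    · simpa using SaturatedPath.top (α := α)
    · have htop : (⊤ : α) ∈ S := mem_of_isMaxChain_of_comparable hS fun y _ => Or.inr le_top
      obtain ⟨b, ⟨hbS, hab⟩, hmin⟩ := wellFounded_lt.has_min (S ∩ Set.Ioi a)
        ⟨⊤, htop, lt_top_iff_ne_top.mpr hne⟩
      have hleast : ∀ y ∈ S, a < y → b ≤ y := fun y hy hay =>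
        (hS.1.total hbS hy).elim id fun hyb =>
          (eq_or_lt_of_le hyb).elim Eq.ge fun h => absurd h (hmin y ⟨hy, hay⟩)
      have hcov : a ⋖ b := by
        refine ⟨hab, fun z haz hzb => hmin z ⟨?_, haz⟩ hzb⟩
        refine mem_of_isMaxChain_of_comparable hS fun y hy => ?_
        rcases hS.1.total ha hy with hay | hya
        · rcases eq_or_lt_of_le hay with rfl | hay
          · exact Or.inr haz.le
          · exact Or.inl (hzb.le.trans (hleast y hy hay))
        · exact Or.inr (hya.trans haz.le)
      have hsplit : S ∩ Set.Ioi a = insert b (S ∩ Set.Ioi b) := by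
        ext y
        constructor
        · rintro ⟨hy, hay⟩
          rcases eq_or_lt_of_le (hleast y hy hay) with rfl | hby
          · exact Set.mem_insert _ _
          · exact Or.inr ⟨hy, hby⟩
        · rintro (rfl | ⟨hy, hby⟩)
          · exact ⟨hbS, hab⟩
          · exact ⟨hy, hab.trans hby⟩
      rw [hsplit, Set.ncard_insert_of_notMem (by simp)]
      exact .step hcov (ih b hab hbS)

/-- In a finite bounded order with the diamond property, all maximal chains have the same size. -/
theorem IsMaxChain.ncard_eq_of_diamond [OrderBot α] [Finite α]
    (hdiamond : ∀ a b c : α, b ≠ c → a ⋖ b → a ⋖ c → ∃ j, b ⋖ j ∧ c ⋖ j)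
    {S T : Set α} (hS : IsMaxChain (· ≤ ·) S) (hT : IsMaxChain (· ≤ ·) T) :
    S.ncard = T.ncard := by
  have hcard : ∀ U : Set α, IsMaxChain (· ≤ ·) U →
      U.ncard = (U ∩ Set.Ioi ⊥).ncard + 1 ∧ SaturatedPath (⊥ : α) (U ∩ Set.Ioi ⊥).ncard := by
    intro U hU
    have hbot : (⊥ : α) ∈ U := mem_of_isMaxChain_of_comparable hU fun y _ => Or.inl bot_le
    refine ⟨?_, saturatedPath_ncard_of_isMaxChain hU hbot⟩
    rw [← Set.ncard_insert_of_notMem (a := (⊥ : α)) (by simp)]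
    congr 1
    ext y
    rcases eq_or_ne y ⊥ with rfl | hy
    · simp [hbot]
    · simp [hy, bot_lt_iff_ne_bot]
  rw [(hcard S hS).1, (hcard T hT).1, (hcard S hS).2.length_unique hdiamond (hcard T hT).2]

end SaturatedPath

theorem exists_isJoinIn {r : Fin d → ℕ} {F : Set (Fin d → ℕ)} (hF : ∀ x ∈ F, mem r x)
    (hF1 : r ∈ F) (hF2 : ∀ a ∈ F, ∀ b ∈ F, a ⊓ b ∈ F) {a b : Fin d → ℕ} (ha : a ∈ F)
    (hb : b ∈ F) : ∃ j, IsJoinIn F a b j := by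
  obtain ⟨j, ⟨hjF, haj, hbj⟩, hj⟩ :=
    exists_isLeast_of_infClosed (s := {u | u ∈ F ∧ a ≤ u ∧ b ≤ u})
      (fun u hu v hv => ⟨hF2 u hu.1 v hv.1, le_inf hu.2.1 hv.2.1, le_inf hu.2.2 hv.2.2⟩)
      ⟨r, hF1, hF a ha, hF b hb⟩
  exact ⟨j, hjF, haj, hbj, fun u hu hau hbu => hj ⟨hu, hau, hbu⟩⟩

theorem CoversIn.eq_of_lt_of_le {F : Set (Fin d → ℕ)} {a b z : Fin d → ℕ} (h : CoversIn F a b)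
    (hz : z ∈ F) (haz : a < z) (hzb : z ≤ b) : z = b :=
  (eq_or_lt_of_le hzb).resolve_right fun hlt => h.2.2.2 z hz ⟨haz, hlt⟩

theorem CoversIn.covers_join {r : Fin d → ℕ} {F : Set (Fin d → ℕ)} (hF : ∀ x ∈ F, mem r x)
    (hF2 : ∀ a ∈ F, ∀ b ∈ F, a ⊓ b ∈ F)
    (hF3 : ∀ a ∈ F, ∀ i : Fin d, mem r (a + e d i) → ∃ b ∈ F, a + e d i ≤ b ∧ CoversIn F a b)
    {a b c j : Fin d → ℕ} (hbc : b ≠ c) (hab : CoversIn F a b) (hac : CoversIn F a c)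
    (hj : IsJoinIn F b c j) : CoversIn F b j := by
  obtain ⟨hjF, hbj, hcj, hjmin⟩ := hj
  have hcb : ¬c ≤ b := fun h => hbc (hab.eq_of_lt_of_le hac.2.1 hac.2.2.1 h).symm
  have hinf : b ⊓ c = a := by
    by_contra hne
    have hlt : a < b ⊓ c := (le_inf hab.2.2.1.le hac.2.2.1.le).lt_of_ne' hne
    have heq := hac.eq_of_lt_of_le (hF2 b hab.2.1 c hac.2.1) hlt inf_le_right
    exact hcb (inf_eq_right.mp heq)
  obtain ⟨-, i, hi⟩ := Pi.lt_def.mp hac.2.2.1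
  have hbi : b i < c i := by
    have h := congrFun hinf i
    rw [Pi.inf_apply] at h
    omega
  have hmem : mem r (b + e d i) := by
    intro k
    have h₁ := hF b hab.2.1 k
    have h₂ := hF c hac.2.1 k
    by_cases hk : k = i
    · subst hk
      simp only [Pi.add_apply, e, if_true]
      omega
    · simpa [e, hk] using h₁
  obtain ⟨b', hb'F, hle, hcov⟩ := hF3 b hab.2.1 i hmem
  have hcb' : c ≤ b' := by
    refine inf_eq_right.mp (hac.eq_of_lt_of_le (hF2 b' hb'F c hac.2.1) ?_ inf_le_right)
    refine Pi.lt_def.mpr ⟨le_inf (hab.2.2.1.le.trans hcov.2.2.1.le) hac.2.2.1.le, i, ?_⟩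
    have h := hle i
    have ha : a i ≤ b i := hab.2.2.1.le i
    simp only [Pi.add_apply, e, if_true] at h
    rw [Pi.inf_apply]
    omega
  have hlt : b < j := hbj.lt_of_ne fun h => hcb (h ▸ hcj)
  rw [hcov.eq_of_lt_of_le hjF hlt (hjmin b' hb'F hcov.2.2.1.le hcb')]
  exact hcov

theorem IsJoinIn.symm {F : Set (Fin d → ℕ)} {a b j : Fin d → ℕ} (h : IsJoinIn F a b j) :
    IsJoinIn F b a j :=
  ⟨h.1, h.2.2.1, h.2.1, fun u hu hbu hau => h.2.2.2 u hu hau hbu⟩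

theorem coversIn_iff_covBy {F : Set (Fin d → ℕ)} (a b : F) : CoversIn F a b ↔ a ⋖ b :=
  ⟨fun h => ⟨h.2.2.1, fun z haz hzb => h.2.2.2 z z.2 ⟨haz, hzb⟩⟩,
    fun h => ⟨a.2, b.2, h.1, fun z hz hlt => h.2 (c := ⟨z, hz⟩) hlt.1 hlt.2⟩⟩

theorem MaxChainIn.isMaxChain_preimage {F S : Set (Fin d → ℕ)} (hS : MaxChainIn F S) :
    IsMaxChain (· ≤ ·) ((↑) ⁻¹' S : Set F) := by
  refine ⟨fun x hx y hy hxy => hS.2.1 hx hy (Subtype.coe_injective.ne hxy), fun T hT hle => ?_⟩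
  have hST : S ⊆ (↑) '' T := fun x hx => ⟨⟨x, hS.1 hx⟩, hle hx, rfl⟩
  have hchain : IsChain (· ≤ ·) ((↑) '' T : Set (Fin d → ℕ)) := by
    rintro _ ⟨x, hx, rfl⟩ _ ⟨y, hy, rfl⟩ hxy
    exact hT hx hy fun h => hxy (congrArg _ h)
  rw [hS.2.2 _ (Subtype.coe_image_subset F T) hchain hST,
    Set.preimage_image_eq T Subtype.coe_injective]

theorem MaxChainIn.ncard_preimage {F S : Set (Fin d → ℕ)} (hS : MaxChainIn F S) :
    ((↑) ⁻¹' S : Set F).ncard = S.ncard :=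
  Set.ncard_preimage_of_injective_subset_range Subtype.coe_injective
    (by simpa using hS.1)

/-- A subset `F ⊆ C(r)` satisfying (F1) and (F2) is a lattice; if it moreover satisfies
(F3), then it has the diamond property, and consequently all its maximal chains have
the same length. -/
theorem flats_axioms_lattice_diamond (d : ℕ) (r : Fin d → ℕ) (F : Set (Fin d → ℕ))
    (hF : ∀ x ∈ F, mem r x)
    (hF1 : r ∈ F)
    (hF2 : ∀ a ∈ F, ∀ b ∈ F, a ⊓ b ∈ F) :
    (∀ a ∈ F, ∀ b ∈ F, ∃ j : Fin d → ℕ, IsJoinIn F a b j) ∧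
    ((∀ a ∈ F, ∀ i : Fin d, mem r (a + e d i) →
        ∃ b ∈ F, a + e d i ≤ b ∧ CoversIn F a b) →
      (∀ a b c : Fin d → ℕ, b ≠ c → CoversIn F a b → CoversIn F a c →
        ∀ j : Fin d → ℕ, IsJoinIn F b c j → CoversIn F b j ∧ CoversIn F c j) ∧
      (∀ S T : Set (Fin d → ℕ), MaxChainIn F S → MaxChainIn F T →
        S.ncard = T.ncard)) := by
  refine ⟨fun a ha b hb => exists_isJoinIn hF hF1 hF2 ha hb, fun hF3 => ?_⟩
  have hdiamond : ∀ a b c : Fin d → ℕ, b ≠ c → CoversIn F a b → CoversIn F a c →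
      ∀ j : Fin d → ℕ, IsJoinIn F b c j → CoversIn F b j ∧ CoversIn F c j :=
    fun a b c hbc hab hac j hj => ⟨hab.covers_join hF hF2 hF3 hbc hac hj,
      hac.covers_join hF hF2 hF3 hbc.symm hab hj.symm⟩
  refine ⟨hdiamond, fun S T hS hT => ?_⟩
  have : Finite F := ((Set.finite_Iic r).subset hF).to_subtype
  obtain ⟨m, hmF, hm⟩ := exists_isLeast_of_infClosed (s := F)
    (fun a ha b hb => hF2 a ha b hb) ⟨r, hF1⟩
  let : OrderTop F := { top := ⟨r, hF1⟩, le_top := fun x => hF x x.2 }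
  let : OrderBot F := { bot := ⟨m, hmF⟩, bot_le := fun x => hm x.2 }
  rw [← hS.ncard_preimage, ← hT.ncard_preimage]
  refine IsMaxChain.ncard_eq_of_diamond ?_ hS.isMaxChain_preimage hT.isMaxChain_preimage
  intro a b c hbc hab hac
  obtain ⟨j, hj⟩ := exists_isJoinIn hF hF1 hF2 b.2 c.2
  have h := hdiamond a b c (Subtype.coe_injective.ne hbc) ((coversIn_iff_covBy a b).mpr hab)
    ((coversIn_iff_covBy a c).mpr hac) j hj
  exact ⟨⟨j, hj.1⟩, (coversIn_iff_covBy b ⟨j, hj.1⟩).mp h.1,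
    (coversIn_iff_covBy c ⟨j, hj.1⟩).mp h.2⟩

end Matricube
end

section
/- Let ρ be the rank function of a matricube on the hypercuboid C(r) and let Ind be its set of independents. Then: (1) Ind is nonempty and closed under the meet ∧ of C(r); and (2) for every p ∈ Ind and every choice of distinct indices i_1, …, i_k ∈ {1, …, d} with p_{i_j} ≥ 1 for all j = 1, …, k, one has ρ(p − e_{i_1} − ⋯ − e_{i_k}) = ρ(p) − k. -/
namespace Matricube

variable {d : ℕ}

theorem mem.mono {r x y : Fin d → ℕ} (hy : mem r y) (hxy : x ≤ y) : mem r x :=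
  fun i => (hxy i).trans (hy i)

/-- Decreasing one coordinate by one drops the rank by at most one. -/
theorem IsRankFunction.rank_le_rank_sub_e_add_one {r : Fin d → ℕ} {ρ : (Fin d → ℕ) → ℤ}
    (h : IsRankFunction r ρ) {m : Fin d → ℕ} (hm : mem r m) {i : Fin d} (hi : 1 ≤ m i) :
    ρ m ≤ ρ (m - e d i) + 1 := by
  have hunit : mem r (unit d i (m i)) := hm.mono fun j => by
    by_cases hj : j = i <;> simp [unit, hj]
  have hsub := h.2.2 (m - e d i) (unit d i (m i)) (hm.mono tsub_le_self) hunit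
  have hjoin : (m - e d i) ⊔ unit d i (m i) = m := by
    ext j
    by_cases hj : j = i <;> simp [unit, e, hj]
  have hmeet : (m - e d i) ⊓ unit d i (m i) = unit d i (m i - 1) := by
    ext j
    by_cases hj : j = i <;> simp [unit, e, hj]
  rw [hjoin, hmeet] at hsub
  have hstep := h.1.2 i (m i) hi (hm i)
  linarith

/-- Below an independent `a`, a point with the same `i`-th coordinate as `a` loses exactly
one in rank when that coordinate is decreased by one. -/
theorem IsIndep.rank_sub_e_of_le {r : Fin d → ℕ} {ρ : (Fin d → ℕ) → ℤ}
    (h : IsRankFunction r ρ) {a m : Fin d → ℕ} (ha : IsIndep r ρ a) (hma : m ≤ a)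
    {i : Fin d} (hmi : m i = a i) (hi : 1 ≤ m i) :
    ρ (m - e d i) = ρ m - 1 := by
  have hm : mem r m := ha.1.mono hma
  have hsub := h.2.2 m (a - e d i) hm (ha.1.mono tsub_le_self)
  have hjoin : m ⊔ (a - e d i) = a := by
    ext j
    have := hma j
    by_cases hj : j = i
    · subst hj
      simp [e, hmi]
    · simp [e, hj, this]
  have hmeet : m ⊓ (a - e d i) = m - e d i := by
    ext j
    have := hma j
    by_cases hj : j = i
    · subst hj
      simp [e, hmi]
    · simp [e, hj, this]
  rw [hjoin, hmeet, ha.2 i (hmi ▸ hi)] at hsub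
  have := h.rank_le_rank_sub_e_add_one hm hi
  linarith

theorem isIndep_zero (r : Fin d → ℕ) (ρ : (Fin d → ℕ) → ℤ) : IsIndep r ρ 0 :=
  ⟨fun _ => Nat.zero_le _, fun _ hi => absurd hi (by simp)⟩

theorem IsIndep.inf {r : Fin d → ℕ} {ρ : (Fin d → ℕ) → ℤ} (h : IsRankFunction r ρ)
    {a b : Fin d → ℕ} (ha : IsIndep r ρ a) (hb : IsIndep r ρ b) : IsIndep r ρ (a ⊓ b) := by
  refine ⟨ha.1.mono inf_le_left, fun i hi => ?_⟩
  rcases le_total (a i) (b i) with hab | hab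
  · exact ha.rank_sub_e_of_le h inf_le_left (inf_eq_left.2 hab) hi
  · exact hb.rank_sub_e_of_le h inf_le_right (inf_eq_right.2 hab) hi

/-- Removing a set of distinct unit vectors from an independent drops the rank by its size. -/
theorem IsIndep.rank_sub_sum_e {r : Fin d → ℕ} {ρ : (Fin d → ℕ) → ℤ}
    (h : IsRankFunction r ρ) {p : Fin d → ℕ} (hp : IsIndep r ρ p) (S : Finset (Fin d))
    (hS : ∀ i ∈ S, 1 ≤ p i) : ρ (p - ∑ i ∈ S, e d i) = ρ p - S.card := by
  induction S using Finset.induction_on with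
  | empty => simp
  | insert i S hiS ih =>
    have hcoord : (p - ∑ j ∈ S, e d j) i = p i := by
      simp [e, hiS]
    rw [Finset.sum_insert hiS, add_comm, ← tsub_tsub,
      hp.rank_sub_e_of_le h tsub_le_self hcoord
        (hcoord.symm ▸ hS i (Finset.mem_insert_self i S)),
      ih fun j hj => hS j (Finset.mem_insert_of_mem hj), Finset.card_insert_of_notMem hiS]
    push_cast
    ring

/-- The set of independents of a matricube is nonempty and closed under meet, and
removing `k` distinct unit vectors from an independent drops the rank by `k`. -/
theorem indeps_properties (d : ℕ) (r : Fin d → ℕ) (ρ : (Fin d → ℕ) → ℤ)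
    (h : IsRankFunction r ρ) :
    ((indeps r ρ).Nonempty ∧
      ∀ a ∈ indeps r ρ, ∀ b ∈ indeps r ρ, a ⊓ b ∈ indeps r ρ) ∧
    (∀ p ∈ indeps r ρ, ∀ k : ℕ, ∀ ι : Fin k → Fin d, Function.Injective ι →
      (∀ j : Fin k, 1 ≤ p (ι j)) →
      ρ (p - ∑ j : Fin k, e d (ι j)) = ρ p - k) := by
  refine ⟨⟨⟨0, isIndep_zero r ρ⟩, fun a ha b hb => IsIndep.inf h ha hb⟩, ?_⟩
  intro p hp k ι hι hpos
  simpa using IsIndep.rank_sub_sum_e h hp (Finset.univ.map ⟨ι, hι⟩) (by simpa using hpos)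

end Matricube
end

section
/- Let J be an orderable subset of C(r), with size function |·|, satisfying axiom (I2). Then for any two elements a ⊏ b of J such that the set D(a, b) = { k : a_k < b_k } has at least two elements, one has |a| ≤ |b| − 2. -/
namespace Matricube

variable {d : ℕ}

/-- In an orderable subset satisfying (I2), if `a ⊏ b` and `D(a,b)` has at least two
elements, then `|a| ≤ |b| − 2`. -/
theorem size_gap_two (d : ℕ) (r : Fin d → ℕ) (J : Set (Fin d → ℕ))
    (hJ : ∀ x ∈ J, mem r x) (hord : Orderable J)
    (sz : (Fin d → ℕ) → ℕ) (hsz : ∀ a ∈ J, ReducesTo J a (sz a))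
    (hI2 : AxiomI2 J sz)
    (a b : Fin d → ℕ) (ha : a ∈ J) (hb : b ∈ J) (hab : a < b)
    (hD : 2 ≤ {k : Fin d | a k < b k}.ncard) :
    sz a + 2 ≤ sz b := by
  obtain ⟨hmono, hexch⟩ := hI2
  obtain ⟨c, hc, hcab, hac, i, -, hci⟩ := hexch a ha b hb (hmono a ha b hb hab) hD
  have hcb : c < b :=
    lt_of_le_of_ne (hcab.trans (sup_le hab.le le_rfl)) (fun h => hci.ne (congrFun h i))
  have := hmono c hc b hb hcb
  omega

end Matricube
end

section
/- Let P be a permutation array of width r and dimension d. Then the function ρ_P defined by ρ_P(a) = r + 1 − rank(P[a]) for every a ∈ [r]^d is the rank function of a simple matricube M_P on the hypercube [r]^d. The rank of M_P is r if the position (r, …, r) is dotted in P, and r + 1 otherwise. Moreover, the set of flats of M_P is exactly the union of the set of dotted positions of P, the set R(P) of redundant positions of P, and {(r, …, r)}. -/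
namespace Matricube

variable {d : ℕ}

lemma add_e_self (a : Fin d → ℕ) (i : Fin d) : (a + e d i) i = a i + 1 := by
  simp [e]

lemma add_e_of_ne (a : Fin d → ℕ) {i k : Fin d} (h : k ≠ i) : (a + e d i) k = a k := by
  simp [e, h]

lemma add_e_le_iff {a y : Fin d → ℕ} {i : Fin d} : a + e d i ≤ y ↔ a ≤ y ∧ a i < y i := by
  constructor
  · intro h
    refine ⟨le_self_add.trans h, ?_⟩
    have hi : (a + e d i) i ≤ y i := h i
    rwa [add_e_self] at hi
  · rintro ⟨h, hi⟩ k
    by_cases hk : k = i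
    · subst hk
      rw [add_e_self]
      exact hi
    · rw [add_e_of_ne a hk]
      exact h k

/-- A function whose increments in each direction `i` decrease when the other coordinates grow
is submodular. -/
lemma submodular_of_local {r : Fin d → ℕ} {f : (Fin d → ℕ) → ℤ}
    (hf : ∀ (a b : Fin d → ℕ) (i : Fin d), a ≤ b → a i = b i → mem r (b + e d i) →
      f (b + e d i) - f b ≤ f (a + e d i) - f a) : Submodular r f := by
  intro x y hx hy
  have key : ∀ (n : ℕ) (z : Fin d → ℕ), ∑ k, (x k - z k) = n → x ⊓ y ≤ z → z ≤ x →
      f (x ⊔ y) - f x ≤ f (z ⊔ y) - f z := by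
    intro n
    induction n with
    | zero =>
      intro z hn _ hz
      have : z = x := by
        funext k
        have h0 := (Finset.sum_eq_zero_iff.mp hn) k (Finset.mem_univ k)
        have hzk : z k ≤ x k := hz k
        omega
      rw [this]
    | succ n ih =>
      intro z hn hmz hz
      obtain ⟨i, -, hi⟩ := Finset.exists_ne_zero_of_sum_ne_zero (by omega : ∑ k, (x k - z k) ≠ 0)
      have hlt : z i < x i := by omega
      have hyz : y i ≤ z i := by
        have := hmz i
        simp only [Pi.inf_apply] at this
        omega
      have hzx : z + e d i ≤ x := add_e_le_iff.mpr ⟨hz, hlt⟩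
      have hsup : (z + e d i) ⊔ y = (z ⊔ y) + e d i := by
        funext k
        by_cases hk : k = i
        · subst hk
          rw [add_e_self, Pi.sup_apply, add_e_self, Pi.sup_apply]
          omega
        · rw [add_e_of_ne _ hk, Pi.sup_apply, add_e_of_ne _ hk, Pi.sup_apply]
      have hsum : ∑ k, (x k - (z + e d i) k) = n := by
        have h1 : ∑ k, (x k - z k) = ∑ k, ((x k - (z + e d i) k) + e d i k) := by
          refine Finset.sum_congr rfl fun k _ => ?_
          have := hzx k
          simp only [Pi.add_apply] at this ⊢
          omega
        rw [Finset.sum_add_distrib] at h1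
        have h2 : ∑ k, e d i k = 1 := by simp [e]
        omega
      have hmem : mem r ((z ⊔ y) + e d i) := by
        intro k
        rw [← hsup]
        exact (sup_le_sup_right hzx y k).trans (sup_le (hx k) (hy k))
      have h1 := ih (z + e d i) hsum (hmz.trans le_self_add) hzx
      have h2 := hf z (z ⊔ y) i le_sup_left (by simp [hyz]) hmem
      rw [hsup] at h1
      linarith
  have h := key _ (x ⊓ y) rfl le_rfl inf_le_left
  rw [sup_eq_right.mpr (inf_le_right : x ⊓ y ≤ y)] at h
  linarith

section DotArray

variable {r : ℕ} {P : Set (Fin d → ℕ)}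

lemma IsDotArray.finite (hP : IsDotArray r P) : P.Finite :=
  (Set.finite_Iic (fun _ : Fin d => r)).subset fun y hy => hP y hy

lemma IsDotArray.finite_values (hP : IsDotArray r P) (a : Fin d → ℕ) (j : Fin d) :
    {t : ℕ | ∃ y ∈ P, a ≤ y ∧ y j = t}.Finite :=
  (hP.finite.image fun y => y j).subset fun _ ⟨y, hy, _, h⟩ => ⟨y, hy, h⟩

lemma IsDotArray.arrayRank_anti (hP : IsDotArray r P) {a b : Fin d → ℕ} (hab : a ≤ b)
    (j : Fin d) : arrayRank P b j ≤ arrayRank P a j :=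
  Set.ncard_le_ncard (fun _ ⟨y, hy, h, ht⟩ => ⟨y, hy, hab.trans h, ht⟩) (hP.finite_values a j)

lemma IsDotArray.arrayRank_eq_add_one (hP : IsDotArray r P) {a : Fin d → ℕ} {i : Fin d}
    (h : ∃ y ∈ P, a ≤ y ∧ y i = a i) :
    arrayRank P a i = arrayRank P (a + e d i) i + 1 := by
  have heq : {t : ℕ | ∃ y ∈ P, a ≤ y ∧ y i = t} =
      insert (a i) {t : ℕ | ∃ y ∈ P, a + e d i ≤ y ∧ y i = t} := by
    ext t
    simp only [Set.mem_insert_iff, Set.mem_ofPred_eq, add_e_le_iff]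
    constructor
    · rintro ⟨y, hy, hay, rfl⟩
      rcases (hay i).eq_or_lt with h' | h'
      · exact Or.inl h'.symm
      · exact Or.inr ⟨y, hy, ⟨hay, h'⟩, rfl⟩
    · rintro (rfl | ⟨y, hy, hay, rfl⟩)
      · exact h
      · exact ⟨y, hy, hay.1, rfl⟩
  unfold arrayRank
  rw [heq, Set.ncard_insert_of_notMem _ (hP.finite_values _ i)]
  rintro ⟨y, -, hay, hy⟩
  have := (add_e_le_iff.mp hay).2
  omega

lemma arrayRank_eq_of_not_exists {a : Fin d → ℕ} {i : Fin d}
    (h : ¬∃ y ∈ P, a ≤ y ∧ y i = a i) :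
    arrayRank P a i = arrayRank P (a + e d i) i := by
  unfold arrayRank
  congr 1
  ext t
  simp only [Set.mem_ofPred_eq, add_e_le_iff]
  constructor
  · rintro ⟨y, hy, hay, rfl⟩
    exact ⟨y, hy, ⟨hay, (hay i).lt_of_ne fun h' => h ⟨y, hy, hay, h'.symm⟩⟩, rfl⟩
  · rintro ⟨y, hy, hay, rfl⟩
    exact ⟨y, hy, hay.1, rfl⟩

lemma mem_of_mem_add_e {s a : Fin d → ℕ} {i : Fin d} (h : mem s (a + e d i)) : mem s a :=
  fun k => (le_self_add : a ≤ a + e d i) k |>.trans (h k)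

lemma IsPermutationArray.arrayRank_eq_add_one_iff (hP : IsPermutationArray r P)
    {a : Fin d → ℕ} {i : Fin d} (ha : mem (fun _ => r) (a + e d i)) (j : Fin d) :
    arrayRank P a j = arrayRank P (a + e d i) j + 1 ↔ ∃ y ∈ P, a ≤ y ∧ y i = a i := by
  rw [hP.2.1 a (mem_of_mem_add_e ha) j i, hP.2.1 _ ha j i]
  refine ⟨fun h => ?_, hP.1.arrayRank_eq_add_one⟩
  by_contra hc
  have := arrayRank_eq_of_not_exists hc
  omega

lemma IsPermutationArray.arrayRank_le_add_one (hP : IsPermutationArray r P)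
    {a : Fin d → ℕ} {i : Fin d} (ha : mem (fun _ => r) (a + e d i)) (j : Fin d) :
    arrayRank P a j ≤ arrayRank P (a + e d i) j + 1 := by
  rw [hP.2.1 a (mem_of_mem_add_e ha) j i, hP.2.1 _ ha j i]
  by_cases hc : ∃ y ∈ P, a ≤ y ∧ y i = a i
  · exact (hP.1.arrayRank_eq_add_one hc).le
  · exact (arrayRank_eq_of_not_exists hc).le.trans (Nat.le_succ _)

lemma IsPermutationArray.submodular (hP : IsPermutationArray r P) (j : Fin d) :
    Submodular (fun _ => r) (fun a => (r : ℤ) + 1 - arrayRank P a j) := by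
  refine submodular_of_local fun a b i hab hi hb => ?_
  have ha : mem (fun _ => r) (a + e d i) := fun k =>
    (add_le_add_left hab (e d i) k).trans (hb k)
  have h1 := hP.arrayRank_le_add_one hb j
  have h2 := hP.1.arrayRank_anti (le_self_add : a ≤ a + e d i) j
  by_cases hc : arrayRank P b j = arrayRank P (b + e d i) j + 1
  · obtain ⟨y, hy, hby, hyi⟩ := (hP.arrayRank_eq_add_one_iff hb j).mp hc
    have h3 := (hP.arrayRank_eq_add_one_iff ha j).mpr ⟨y, hy, hab.trans hby, hyi.trans hi.symm⟩
    omega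
  · omega

lemma IsPermutationArray.exists_apply_eq (hP : IsPermutationArray r P) (i : Fin d) {t : ℕ}
    (ht : t ≤ r) : ∃ y ∈ P, y i = t := by
  have hsub : {t : ℕ | ∃ y ∈ P, 0 ≤ y ∧ y i = t} ⊆ Set.Iic r := by
    rintro _ ⟨y, hy, -, rfl⟩
    exact hP.1 y hy i
  have heq := Set.eq_of_subset_of_ncard_le hsub (by
    have h := hP.2.2.1 i
    unfold arrayRank at h
    rw [h, Set.ncard_eq_toFinset_card']
    simp) (Set.finite_Iic r)
  have hmem : t ∈ Set.Iic r := ht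
  rw [← heq] at hmem
  obtain ⟨y, hy, -, h⟩ := hmem
  exact ⟨y, hy, h⟩

lemma unit_le_iff {i : Fin d} {t : ℕ} {y : Fin d → ℕ} : unit d i t ≤ y ↔ t ≤ y i := by
  constructor
  · intro h
    simpa [unit] using h i
  · intro h k
    by_cases hk : k = i
    · subst hk
      simpa [unit] using h
    · simp [unit, hk]

lemma IsPermutationArray.arrayRank_unit (hP : IsPermutationArray r P) (i j : Fin d) {t : ℕ}
    (ht : t ≤ r) : arrayRank P (unit d i t) j = r + 1 - t := by
  rw [hP.2.1 _ (unit_le_iff.mpr ht : unit d i t ≤ fun _ => r) j i]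
  have : {s : ℕ | ∃ y ∈ P, unit d i t ≤ y ∧ y i = s} = Set.Icc t r := by
    ext s
    simp only [Set.mem_ofPred_eq, unit_le_iff, Set.mem_Icc]
    constructor
    · rintro ⟨y, hy, hty, rfl⟩
      exact ⟨hty, hP.1 y hy i⟩
    · rintro ⟨hts, hsr⟩
      obtain ⟨y, hy, rfl⟩ := hP.exists_apply_eq i hsr
      exact ⟨y, hy, hts, rfl⟩
  unfold arrayRank
  rw [this, Set.ncard_eq_toFinset_card']
  simp

lemma IsDotArray.eq_top_of_le (hP : IsDotArray r P) {y : Fin d → ℕ} (hy : y ∈ P)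
    (h : (fun _ => r) ≤ y) : y = fun _ => r :=
  le_antisymm (fun k => hP y hy k) h

lemma IsDotArray.arrayRank_top_of_mem (hP : IsDotArray r P) (h : (fun _ => r) ∈ P)
    (j : Fin d) : arrayRank P (fun _ => r) j = 1 := by
  unfold arrayRank
  rw [Set.ncard_eq_one]
  refine ⟨r, Set.eq_singleton_iff_unique_mem.mpr ⟨⟨_, h, le_rfl, rfl⟩, ?_⟩⟩
  rintro _ ⟨y, hy, hle, rfl⟩
  rw [hP.eq_top_of_le hy hle]

lemma IsDotArray.arrayRank_top_of_notMem (hP : IsDotArray r P) (h : (fun _ => r) ∉ P)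
    (j : Fin d) : arrayRank P (fun _ => r) j = 0 := by
  unfold arrayRank
  rw [Set.ncard_eq_zero (hP.finite_values _ j), Set.eq_empty_iff_forall_notMem]
  rintro _ ⟨y, hy, hle, rfl⟩
  exact h (hP.eq_top_of_le hy hle ▸ hy)

/-- If `x` is the meet of a finite set `S`, each coordinate of `x` is attained in `S`. -/
lemma exists_apply_eq_of_isGLB {S : Finset (Fin d → ℕ)} {x : Fin d → ℕ}
    (hle : ∀ y ∈ S, x ≤ y) (hglb : ∀ z : Fin d → ℕ, (∀ y ∈ S, z ≤ y) → z ≤ x) (i : Fin d) :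
    ∃ y ∈ S, y i = x i := by
  by_contra! hc
  have h := hglb (x + e d i) fun y hy =>
    add_e_le_iff.mpr ⟨hle y hy, (hle y hy i).lt_of_ne (hc y hy).symm⟩
  exact (add_e_le_iff.mp h).2.false

lemma IsPermutationArray.isFlat_iff (hP : IsPermutationArray r P) {a : Fin d → ℕ}
    (j : Fin d) :
    IsFlat (fun _ => r) (fun a => (r : ℤ) + 1 - arrayRank P a j) a ↔
      mem (fun _ => r) a ∧ ∀ i, a i < r → ∃ y ∈ P, a ≤ y ∧ y i = a i := by
  refine and_congr_right fun ha => forall_congr' fun i => ?_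
  have hiff : mem (fun _ => r) (a + e d i) ↔ a i < r :=
    add_e_le_iff.trans (and_iff_right ha)
  rw [hiff]
  refine forall_congr' fun hi => ?_
  rw [← hP.arrayRank_eq_add_one_iff (hiff.mpr hi) j]
  dsimp only
  omega

lemma IsDotArray.redundant_of_forall_exists (hP : IsDotArray r P) {a : Fin d → ℕ}
    (ha : mem (fun _ => r) a) (haP : a ∉ P) (hne : a ≠ fun _ => r)
    (h : ∀ i, a i < r → ∃ y ∈ P, a ≤ y ∧ y i = a i) : Redundant P a := by
  have hfin : {y | y ∈ P ∧ a ≤ y ∧ ∃ i, y i = a i}.Finite :=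
    hP.finite.subset fun y hy => hy.1
  obtain ⟨i₀, hi₀⟩ : ∃ i, a i < r := by
    by_contra! hc
    exact hne (funext fun i => le_antisymm (ha i) (hc i))
  obtain ⟨y₀, hy₀, hay₀, hyi₀⟩ := h i₀ hi₀
  have hy₀S : y₀ ∈ hfin.toFinset := hfin.mem_toFinset.mpr ⟨hy₀, hay₀, i₀, hyi₀⟩
  have hglb : ∀ z : Fin d → ℕ, (∀ y ∈ hfin.toFinset, z ≤ y) → z ≤ a := by
    intro z hz i
    rcases (ha i).lt_or_eq with hi | hi
    · obtain ⟨y, hy, hay, hyi⟩ := h i hi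
      rw [← hyi]
      exact hz y (hfin.mem_toFinset.mpr ⟨hy, hay, i, hyi⟩) i
    · rw [hi]
      exact (hz y₀ hy₀S i).trans (hP y₀ hy₀ i)
  refine ⟨hfin.toFinset, ?_, ?_, ?_, ?_, hglb⟩
  · by_contra! hcard
    have hsub := Finset.card_le_one.mp (Nat.le_of_lt_succ hcard)
    have hle : y₀ ≤ a := hglb y₀ fun y hy => (hsub y₀ hy₀S y hy).le
    exact haP (le_antisymm hay₀ hle ▸ hy₀)
  · intro y hy
    have hy' := hfin.mem_toFinset.mp hy
    exact ⟨hy'.1, fun hya => haP (hya ▸ hy'.1)⟩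
  · exact fun y hy => (hfin.mem_toFinset.mp hy).2.2
  · exact fun y hy => (hfin.mem_toFinset.mp hy).2.1

lemma IsPermutationArray.flats_eq (hP : IsPermutationArray r P) (j : Fin d) :
    flats (fun _ => r) (fun a => (r : ℤ) + 1 - arrayRank P a j) =
      P ∪ {x | Redundant P x} ∪ {fun _ => r} := by
  ext a
  rw [flats, Set.mem_ofPred_eq, hP.isFlat_iff j]
  constructor
  · rintro ⟨ha, h⟩
    by_cases haP : a ∈ P
    · exact Or.inl (Or.inl haP)
    by_cases hne : a = fun _ => r
    · exact Or.inr hne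
    exact Or.inl (Or.inr (hP.1.redundant_of_forall_exists ha haP hne h))
  · rintro ((haP | ⟨S, -, hSP, -, hle, hglb⟩) | rfl)
    · exact ⟨hP.1 a haP, fun i _ => ⟨a, haP, le_rfl, rfl⟩⟩
    · have key := exists_apply_eq_of_isGLB hle hglb
      refine ⟨fun i => ?_, fun i _ => ?_⟩
      · obtain ⟨y, hy, hyi⟩ := key i
        rw [← hyi]
        exact hP.1 y (hSP hy).1 i
      · obtain ⟨y, hy, hyi⟩ := key i
        exact ⟨y, (hSP hy).1, hle y hy, hyi⟩
    · exact ⟨fun _ => le_rfl, fun _ h => (lt_irrefl _ h).elim⟩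

end DotArray

/-- From a permutation array `P` of width `r` and dimension `d`, the function
`ρ_P(a) = r + 1 − rank(P[a])` is the rank function of a simple matricube on `[r]^d`, of
rank `r` or `r + 1` according to whether the position `(r, …, r)` is dotted or not, whose
flats are exactly the dotted positions, the redundant positions, and `(r, …, r)`. -/
theorem permutation_array_to_matricube (d r : ℕ) (hd : 0 < d) (hr : 0 < r)
    (P : Set (Fin d → ℕ)) (hP : IsPermutationArray r P) (j : Fin d) :
    IsRankFunction (fun _ => r) (fun a => (r : ℤ) + 1 - arrayRank P a j) ∧
    IsSimple (fun _ => r) (fun a => (r : ℤ) + 1 - arrayRank P a j) ∧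
    ((fun _ => r : Fin d → ℕ) ∈ P →
      (r : ℤ) + 1 - arrayRank P (fun _ => r) j = r) ∧
    ((fun _ => r : Fin d → ℕ) ∉ P →
      (r : ℤ) + 1 - arrayRank P (fun _ => r) j = r + 1) ∧
    flats (fun _ => r) (fun a => (r : ℤ) + 1 - arrayRank P a j) =
      P ∪ {x | Redundant P x} ∪ {fun _ => r} := by
  refine ⟨⟨⟨?_, ?_⟩, ?_, hP.submodular j⟩, ?_, ?_, ?_, hP.flats_eq j⟩
  · dsimp only
    rw [hP.2.2.1 j]
    push_cast
    ring
  · intro i t h1 ht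
    dsimp only at ht ⊢
    rw [hP.arrayRank_unit i j ht, hP.arrayRank_unit i j (by omega)]
    omega
  · intro x y _ _ hxy
    have := hP.1.arrayRank_anti hxy j
    dsimp only
    omega
  · refine fun i => ⟨hr, fun t ht => ?_⟩
    dsimp only at ht ⊢
    rw [hP.arrayRank_unit i j ht]
    omega
  · intro h
    rw [hP.1.arrayRank_top_of_mem h j]
    simp
  · intro h
    rw [hP.1.arrayRank_top_of_notMem h j]
    simp

end Matricube
end
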